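/- Let K/ℚ be a Galois extension of degree n ≥ 3 with cyclic Galois group and let σ be a generator of Gal(K/ℚ). Let 𝔮 be an odd nonzero integral ideal of 𝓞 and suppose there is a rational prime p, unramified in K, with p ∣ N𝔮 and p² ∤ N𝔮. Write 𝔮' = σ(𝔮) and 𝔮⁻ = σ⁻¹(𝔮). Then ∑_{α} (α / 𝔮'𝔮⁻) = 0, where α runs over any complete set of representatives of the residue classes of 𝓞 modulo 𝔮'𝔮⁻ (the symbol (α/𝔮'𝔮⁻) depends only on the class of α modulo 𝔮'𝔮⁻, so the sum is well-defined). -/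

import Mathlib

set_option synthInstance.maxHeartbeats 1000000
set_option maxHeartbeats 2000000

open NumberField
open scoped Classical

noncomputable section

variable {K : Type*} [Field K] [NumberField K]

/-- The quadratic residue symbol `(α/𝔭)` modulo a prime ideal `𝔭`. -/
def legSym (𝔭 : Ideal (𝓞 K)) (α : 𝓞 K) : ℤ :=
  if Ideal.Quotient.mk 𝔭 α = 0 then 0
  else if IsSquare (Ideal.Quotient.mk 𝔭 α) then 1 else -1

/-- The quadratic residue symbol `(α/𝔟)` for an ideal `𝔟`, extended multiplicatively over
the prime factorization of `𝔟` (with multiplicity). -/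
def quadSym (𝔟 : Ideal (𝓞 K)) (α : 𝓞 K) : ℤ :=
  ((UniqueFactorizationMonoid.normalizedFactors 𝔟).map (fun 𝔭 => legSym 𝔭 α)).prod

/-- The image of an ideal under a field automorphism. -/
def galMap (σ : K ≃ₐ[ℚ] K) (𝔞 : Ideal (𝓞 K)) : Ideal (𝓞 K) :=
  Ideal.map (RingOfIntegers.mapRingHom (σ : K →+* K)) 𝔞

open scoped Pointwise in
theorem galMap_eq_smul (σ : K ≃ₐ[ℚ] K) (I : Ideal (𝓞 K)) : galMap σ I = σ • I := rfl

/-- If a rational prime `p` divides the norm of `I` exactly once, then a single prime ideal of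
norm `p` accounts for this. -/
theorem exists_eq_mul_of_dvd_absNorm {I : Ideal (𝓞 K)} (hI : I ≠ ⊥) {p : ℕ} (hp : p.Prime)
    (hdvd : p ∣ Ideal.absNorm I) (hsq : ¬ p ^ 2 ∣ Ideal.absNorm I) :
    ∃ P J : Ideal (𝓞 K), I = P * J ∧ P.IsPrime ∧ Ideal.absNorm P = p ∧
      ¬ p ∣ Ideal.absNorm J := by
  have hprod := Ideal.prod_normalizedFactors_eq_self hI
  obtain ⟨P, hP, hpP⟩ : ∃ P ∈ UniqueFactorizationMonoid.normalizedFactors I,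
      p ∣ Ideal.absNorm P := by
    apply (Nat.prime_iff.mp hp).exists_mem_multiset_map_dvd
    rwa [← map_multiset_prod, hprod]
  have hP' := UniqueFactorizationMonoid.prime_of_normalized_factor P hP
  have hPp : P.IsPrime := Ideal.isPrime_of_prime hP'
  obtain ⟨J, rfl⟩ := UniqueFactorizationMonoid.dvd_of_mem_normalizedFactors hP
  have : NeZero P := ⟨hP'.ne_zero⟩
  have hℓ := Nat.absNorm_under_prime P
  have hN := Ideal.absNorm_eq_pow_inertiaDeg' P hℓ
  obtain rfl : p = _ := (Nat.prime_dvd_prime_iff_eq hp hℓ).mp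
    (hp.dvd_of_dvd_pow (hN ▸ hpP))
  have hPN : ∀ m, Ideal.absNorm P = Ideal.absNorm (Ideal.under ℤ P) ^ m → m = 1 := by
    intro m hm
    have h0 : m ≠ 0 := by
      rintro rfl
      rw [hm, pow_zero] at hpP
      exact hℓ.one_lt.ne' (Nat.dvd_one.mp hpP)
    have h2 : ¬ 2 ≤ m := fun h ↦ hsq <| by
      rw [map_mul, hm]
      exact (pow_dvd_pow _ h).mul_right _
    omega
  have h1 : Ideal.absNorm P = Ideal.absNorm (Ideal.under ℤ P) := by
    conv_lhs => rw [hN, hPN _ hN, pow_one]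
  refine ⟨P, J, rfl, hPp, h1, fun h ↦ hsq ?_⟩
  rw [map_mul, h1, sq]
  exact mul_dvd_mul_left _ h

open scoped Pointwise in
/-- A prime ideal of prime norm `p` with `p` unramified has trivial decomposition group. -/
theorem eq_one_of_smul_eq [IsGalois ℚ K] {p : ℕ} (hp : p.Prime)
    (hunr : Squarefree (Ideal.span {(p : 𝓞 K)})) {P : Ideal (𝓞 K)} [P.IsPrime]
    (hP : Ideal.absNorm P = p) {τ : K ≃ₐ[ℚ] K} (hτ : τ • P = P) : τ = 1 := by
  have hP0 : P ≠ ⊥ := by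
    rintro rfl
    exact hp.ne_zero (by simpa using hP.symm)
  have hpP : (p : 𝓞 K) ∈ P := hP ▸ Ideal.absNorm_mem P
  have : NeZero P := ⟨hP0⟩
  have hℓ := Nat.absNorm_under_prime P
  have hℓp : Ideal.absNorm (Ideal.under ℤ P) = p := by
    refine (Nat.prime_dvd_prime_iff_eq hℓ hp).mp ?_
    have := (Int.cast_mem_ideal_iff (I := P) (d := (p : ℤ))).mp (by simpa using hpP)
    exact_mod_cast this
  have hlies : P.LiesOver (Ideal.span {(p : ℤ)}) := hℓp ▸ Int.liesOver_span_absNorm P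
  have hmax : (Ideal.span {(p : ℤ)}).IsMaximal :=
    have : Fact p.Prime := ⟨hp⟩
    Int.ideal_span_isMaximal_of_prime p
  have hPmax : P.IsMaximal := Ideal.IsPrime.isMaximal ‹_› hP0
  have hinert : P.inertiaDeg ℤ = 1 := by
    have := Ideal.absNorm_pow_inertiaDeg (Ideal.span {(p : ℤ)}) P
    rw [hP, Ideal.absNorm_span_singleton] at this
    simp only [Algebra.norm_self, MonoidHom.id_apply, Int.natAbs_natCast] at this
    exact Nat.pow_right_injective hp.two_le (by simpa using this)
  have hpmap : (Ideal.span {(p : ℤ)}).map (algebraMap ℤ (𝓞 K)) = Ideal.span {(p : 𝓞 K)} := by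
    simp [Ideal.map_span]
  have hram : P.ramificationIdx ℤ = 1 := by
    rw [← Ideal.ramificationIdx'_eq_ramificationIdx (Ideal.span {(p : ℤ)}) P
      (by simpa using hp.ne_zero)]
    apply Ideal.ramificationIdx'_spec
    · rw [hpmap, pow_one, Ideal.span_singleton_le_iff_mem]
      exact hpP
    · rw [hpmap, ← Ideal.dvd_iff_le]
      intro h
      exact Ideal.IsPrime.ne_top ‹_› (Ideal.isUnit_iff.mp (hunr P (by simpa [sq] using h)))
  have hcard := Ideal.card_stabilizer_eq (G := K ≃ₐ[ℚ] K) (Ideal.span {(p : ℤ)}) P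
  rw [Ideal.ramificationIdxIn_eq_ramificationIdx _ P (K ≃ₐ[ℚ] K),
    Ideal.inertiaDegIn_eq_inertiaDeg _ P (K ≃ₐ[ℚ] K), hram, hinert, mul_one] at hcard
  have hbot := Subgroup.card_eq_one.mp hcard
  have : τ ∈ MulAction.stabilizer (K ≃ₐ[ℚ] K) P := hτ
  rwa [hbot, Subgroup.mem_bot] at this

theorem legSym_eq_of_sub_mem {P : Ideal (𝓞 K)} {a b : 𝓞 K} (h : a - b ∈ P) :
    legSym P a = legSym P b := by
  rw [legSym, legSym, Ideal.Quotient.eq.mpr h]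

theorem quadSym_eq_of_sub_mem {I : Ideal (𝓞 K)} {a b : 𝓞 K} (h : a - b ∈ I) :
    quadSym I a = quadSym I b := by
  refine congrArg Multiset.prod (Multiset.map_congr rfl fun P hP ↦ legSym_eq_of_sub_mem ?_)
  exact Ideal.le_of_dvd (UniqueFactorizationMonoid.dvd_of_mem_normalizedFactors hP) h

theorem quadSym_mul {I J : Ideal (𝓞 K)} (hI : I ≠ ⊥) (hJ : J ≠ ⊥) (a : 𝓞 K) :
    quadSym (I * J) a = quadSym I a * quadSym J a := by
  rw [quadSym, UniqueFactorizationMonoid.normalizedFactors_mul hI hJ, Multiset.map_add,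
    Multiset.prod_add, quadSym, quadSym]

theorem quadSym_of_isPrime {P : Ideal (𝓞 K)} [hP : P.IsPrime] (hP0 : P ≠ ⊥) (a : 𝓞 K) :
    quadSym P a = legSym P a := by
  have hirr : Irreducible P := (Ideal.prime_of_isPrime hP0 hP).irreducible
  rw [quadSym, UniqueFactorizationMonoid.normalizedFactors_irreducible hirr]
  simp

theorem exists_quadraticChar_mul_eq_neg {F : Type*} [Field F] [Fintype F] (hF : ringChar F ≠ 2) :
    ∃ c : F, c ≠ 0 ∧ ∀ x : F, (if c * x = 0 then (0 : ℤ) else if IsSquare (c * x) then 1 else -1) =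
      -(if x = 0 then (0 : ℤ) else if IsSquare x then 1 else -1) := by
  have hif : ∀ x : F, (if x = 0 then (0 : ℤ) else if IsSquare x then 1 else -1) =
      quadraticChar F x := fun x ↦ by
    rw [quadraticChar_apply, quadraticCharFun]
  obtain ⟨c, hc⟩ := quadraticChar_exists_neg_one hF
  refine ⟨c, ?_, fun x ↦ ?_⟩
  · rintro rfl
    rw [quadraticChar_zero] at hc
    norm_num at hc
  · rw [hif, hif, map_mul, hc, neg_one_mul]

/-- Modulo an odd prime there is an element whose multiplication changes the sign of the symbol. -/
theorem exists_legSym_mul_eq_neg {P : Ideal (𝓞 K)} [hP : P.IsPrime] (hP0 : P ≠ ⊥)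
    (h2 : (2 : 𝓞 K) ∉ P) :
    ∃ u : 𝓞 K, u ∉ P ∧ ∀ a, legSym P (u * a) = -legSym P a := by
  have hmax : P.IsMaximal := hP.isMaximal hP0
  let : Field (𝓞 K ⧸ P) := Ideal.Quotient.field P
  have : Finite (𝓞 K ⧸ P) := Ideal.finiteQuotientOfFreeOfNeBot P hP0
  let : Fintype (𝓞 K ⧸ P) := Fintype.ofFinite _
  have hchar : ringChar (𝓞 K ⧸ P) ≠ 2 := by
    intro h
    have h' : ((2 : ℕ) : 𝓞 K ⧸ P) = 0 := h ▸ ringChar.Nat.cast_ringChar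
    apply h2
    exact Ideal.Quotient.eq_zero_iff_mem.mp h'
  obtain ⟨c, hc0, hc⟩ := exists_quadraticChar_mul_eq_neg hchar
  obtain ⟨u, rfl⟩ := Ideal.Quotient.mk_surjective c
  refine ⟨u, fun hu ↦ hc0 (Ideal.Quotient.eq_zero_iff_mem.mpr hu), fun a ↦ ?_⟩
  rw [legSym, legSym, map_mul]
  convert hc (Ideal.Quotient.mk P a)

/-- The complete sum of the quadratic residue symbol modulo `P * J` vanishes when `P` is an odd
prime coprime to `J`. -/
theorem sum_quadSym_eq_zero {P J : Ideal (𝓞 K)} [hP : P.IsPrime] (hP0 : P ≠ ⊥) (hJ : J ≠ ⊥)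
    (h2 : (2 : 𝓞 K) ∉ P) (hPJ : ¬ J ≤ P) (T : Finset (𝓞 K))
    (hT : ∀ c : 𝓞 K ⧸ (P * J), ∃! t : 𝓞 K, t ∈ T ∧ Ideal.Quotient.mk (P * J) t = c) :
    ∑ t ∈ T, quadSym (P * J) t = 0 := by
  have hmax : P.IsMaximal := hP.isMaximal hP0
  have hcop : IsCoprime P J := Ideal.isCoprime_iff_sup_eq.mpr (hmax.out.2 _ (left_lt_sup.mpr hPJ))
  obtain ⟨v, hv, hneg⟩ := exists_legSym_mul_eq_neg hP0 h2
  obtain ⟨i, hi, j, hj, hij⟩ := Ideal.isCoprime_iff_exists.mp hcop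
  obtain ⟨u, huP, huJ⟩ : ∃ u : 𝓞 K, u - v ∈ P ∧ u - 1 ∈ J := by
    refine ⟨v * j + i, ?_, ?_⟩
    · have : v * j + i - v = (1 - v) * i := by linear_combination v * hij
      exact this ▸ P.mul_mem_left _ hi
    · have : v * j + i - 1 = (v - 1) * j := by linear_combination hij
      exact this ▸ J.mul_mem_left _ hj
  have hflip : ∀ a, quadSym (P * J) (u * a) = -quadSym (P * J) a := by
    intro a
    rw [quadSym_mul hP0 hJ, quadSym_mul hP0 hJ, quadSym_of_isPrime hP0, quadSym_of_isPrime hP0,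
      legSym_eq_of_sub_mem (b := v * a) (by rw [← sub_mul]; exact P.mul_mem_right _ huP), hneg,
      quadSym_eq_of_sub_mem (I := J) (a := u * a) (b := a)
        (by simpa [sub_mul] using J.mul_mem_right a huJ), neg_mul]
  have hleP : P * J ≤ P := Ideal.mul_le_left
  have hleJ : P * J ≤ J := Ideal.mul_le_right
  choose r hr hr_unique using hT
  have hr_mk : ∀ a b : 𝓞 K, a ∈ T → Ideal.Quotient.mk (P * J) a = Ideal.Quotient.mk _ b →
      a = r (Ideal.Quotient.mk _ b) := fun a b ha hab ↦ hr_unique _ a ⟨ha, hab⟩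
  have hinj : Set.InjOn (fun t ↦ r (Ideal.Quotient.mk _ (u * t))) (T : Set (𝓞 K)) := by
    intro a ha b hb hab
    have h := congrArg (Ideal.Quotient.mk (P * J)) hab
    simp only [(hr _).2] at h
    rw [Ideal.Quotient.eq, ← mul_sub] at h
    have habP : a - b ∈ P :=
      (hP.mem_or_mem (hleP h)).resolve_left fun hu ↦
        hv (by simpa using P.sub_mem hu huP)
    have habJ : a - b ∈ J := by
      have := J.sub_mem (hleJ h) (J.mul_mem_right (a - b) huJ)
      simpa [sub_mul] using this
    have hmem : a - b ∈ P * J := by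
      rw [Ideal.mul_eq_inf_of_isCoprime hcop]
      exact ⟨habP, habJ⟩
    rw [hr_mk a b ha (Ideal.Quotient.eq.mpr hmem), ← hr_mk b b hb rfl]
  have hmaps : Set.MapsTo (fun t ↦ r (Ideal.Quotient.mk _ (u * t))) (T : Set (𝓞 K)) T :=
    fun t _ ↦ (hr _).1
  have hsum : ∑ t ∈ T, quadSym (P * J) t = ∑ t ∈ T, -quadSym (P * J) t := by
    symm
    refine Finset.sum_nbij _ hmaps hinj (Finset.surjOn_of_injOn_of_card_le _ hmaps hinj le_rfl) ?_
    intro t _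
    rw [← hflip]
    exact quadSym_eq_of_sub_mem (Ideal.Quotient.eq.mp (hr _).2.symm)
  rw [Finset.sum_neg_distrib] at hsum
  linarith

open scoped Pointwise in
/-- The ideal `σ(𝔮)σ⁻¹(𝔮)` has an odd prime factor of multiplicity one. -/
theorem exists_galMap_mul_galMap_eq [IsGalois ℚ K] {n : ℕ} (hn : 3 ≤ n)
    (hdeg : Module.finrank ℚ K = n) {σ : K ≃ₐ[ℚ] K}
    (hσ : ∀ τ : K ≃ₐ[ℚ] K, τ ∈ Subgroup.zpowers σ) {𝔮 : Ideal (𝓞 K)} (h𝔮bot : 𝔮 ≠ ⊥)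
    (h𝔮odd : IsCoprime 𝔮 (Ideal.span {(2 : 𝓞 K)})) {p : ℕ} (hp : p.Prime)
    (hpunram : Squarefree (Ideal.span {(p : 𝓞 K)}))
    (hpdvd : p ∣ Ideal.absNorm 𝔮) (hpsq : ¬ p ^ 2 ∣ Ideal.absNorm 𝔮) :
    ∃ P J : Ideal (𝓞 K), P.IsPrime ∧ P ≠ ⊥ ∧ J ≠ ⊥ ∧ (2 : 𝓞 K) ∉ P ∧ ¬ J ≤ P ∧
      galMap σ 𝔮 * galMap σ⁻¹ 𝔮 = P * J := by
  obtain ⟨P, J, rfl, hP, hPN, hJ⟩ := exists_eq_mul_of_dvd_absNorm h𝔮bot hp hpdvd hpsq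
  have hP0 : P ≠ ⊥ := left_ne_zero_of_mul h𝔮bot
  have hJ0 : J ≠ ⊥ := right_ne_zero_of_mul h𝔮bot
  have hpP : (p : 𝓞 K) ∈ P := hPN ▸ Ideal.absNorm_mem P
  have h2 : (2 : 𝓞 K) ∉ P := by
    intro h
    obtain ⟨a, ha, b, hb, hab⟩ := Ideal.isCoprime_iff_exists.mp h𝔮odd
    refine hP.ne_top ((Ideal.eq_top_iff_one P).mpr ?_)
    rw [← hab]
    have hle : P * J ≤ P := Ideal.mul_le_left
    exact P.add_mem (hle ha) ((Ideal.span_singleton_le_iff_mem P).mpr h hb)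
  have hsmul_bot : ∀ (τ : K ≃ₐ[ℚ] K) (I : Ideal (𝓞 K)), I ≠ ⊥ → τ • I ≠ ⊥ := by
    intro τ I hI h
    apply hI
    rw [← inv_smul_smul τ I, h, Ideal.smul_bot]
  have hprime : ∀ τ : K ≃ₐ[ℚ] K, (τ • P).IsPrime := fun τ ↦ (Ideal.IsPrime.smul_iff τ).mpr hP
  have hnat : ∀ (τ : K ≃ₐ[ℚ] K) (m : ℕ), (m : 𝓞 K) ∈ P ↔ (m : 𝓞 K) ∈ τ • P := by
    intro τ m
    rw [Ideal.mem_pointwise_smul_iff_inv_smul_mem,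
      show τ⁻¹ • (m : 𝓞 K) = m from map_natCast (MulSemiringAction.toRingHom _ (𝓞 K) τ⁻¹) m]
  have hnotle : ∀ τ : K ≃ₐ[ℚ] K, ¬ J ≤ τ • P := by
    intro τ h
    have hmem : ((Ideal.absNorm J : ℕ) : 𝓞 K) ∈ P := (hnat τ _).mpr (h (Ideal.absNorm_mem J))
    have hcop : IsCoprime (p : ℤ) (Ideal.absNorm J : ℤ) :=
      Nat.isCoprime_iff_coprime.mpr ((Nat.Prime.coprime_iff_not_dvd hp).mpr hJ)
    obtain ⟨a, b, hab⟩ := hcop.map (Int.castRingHom (𝓞 K))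
    refine hP.ne_top ((Ideal.eq_top_iff_one P).mpr ?_)
    rw [← hab]
    exact P.add_mem (P.mul_mem_left _ (by simpa using hpP)) (P.mul_mem_left _ (by simpa using hmem))
  have hsq : σ * σ ≠ 1 := by
    intro h
    have hcard : Nat.card (K ≃ₐ[ℚ] K) = n := by rw [IsGalois.card_aut_eq_finrank, hdeg]
    have hord := orderOf_eq_card_of_forall_mem_zpowers hσ
    have := orderOf_le_of_pow_eq_one two_pos (by rwa [← sq] at h : σ ^ 2 = 1)
    omega
  have hfactor : galMap σ (P * J) * galMap σ⁻¹ (P * J) =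
      (σ • P) * ((σ • J) * ((σ⁻¹ • P) * (σ⁻¹ • J))) := by
    rw [galMap_eq_smul, galMap_eq_smul, smul_mul', smul_mul', mul_assoc]
  have := hprime σ
  refine ⟨σ • P, _, hprime σ, hsmul_bot σ P hP0, ?_, ?_, ?_, hfactor⟩
  · exact mul_ne_zero (hsmul_bot _ _ hJ0) (mul_ne_zero (hsmul_bot _ _ hP0) (hsmul_bot _ _ hJ0))
  · exact_mod_cast fun h ↦ h2 (by exact_mod_cast (hnat σ 2).mpr (by exact_mod_cast h))
  · rw [this.mul_le, this.mul_le]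
    rintro (h | h | h)
    · exact hnotle 1 (by simpa using h)
    · have hle : P ≤ (σ * σ) • P := by
        rw [Ideal.pointwise_smul_subset_iff, inv_inv, smul_smul] at h
        exact h
      have heq := (hP.isMaximal hP0).eq_of_le (hprime (σ * σ)).ne_top hle
      exact hsq (eq_one_of_smul_eq hp hpunram hPN heq.symm)
    · rw [Ideal.pointwise_smul_subset_iff, inv_inv, smul_smul] at h
      exact hnotle _ h

/-- **Lemma 2.1** (Friedlander–Iwaniec–Mazur–Rubin, "The spin of prime ideals").
Let `K/ℚ` be cyclic Galois of degree `n ≥ 3` with generator `σ`, and let `𝔮` be an odd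
nonzero ideal whose norm is divisible exactly to the first power by some rational prime
`p` unramified in `K`.  Then, `𝔮' = σ𝔮` and `𝔮⁻ = σ⁻¹𝔮`, the complete character sum
`∑_{α mod 𝔮'𝔮⁻} (α/𝔮'𝔮⁻)` vanishes. -/
theorem spins_of_prime_ideals_stmt14
    (n : ℕ) (hn : 3 ≤ n)
    (K : Type*) [Field K] [NumberField K] [IsGalois ℚ K]
    (hdeg : Module.finrank ℚ K = n)
    (hcyc : IsCyclic (K ≃ₐ[ℚ] K))
    (σ : K ≃ₐ[ℚ] K) (hσ : ∀ τ : K ≃ₐ[ℚ] K, τ ∈ Subgroup.zpowers σ)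
    (𝔮 : Ideal (𝓞 K)) (h𝔮bot : 𝔮 ≠ ⊥)
    (h𝔮odd : IsCoprime 𝔮 (Ideal.span {(2 : 𝓞 K)}))
    (p : ℕ) (hp : p.Prime)
    (hpunram : Squarefree (Ideal.span {(p : 𝓞 K)}))
    (hpdvd : p ∣ Ideal.absNorm 𝔮) (hpsq : ¬ p ^ 2 ∣ Ideal.absNorm 𝔮) :
    ∀ T : Finset (𝓞 K),
      (∀ c : (𝓞 K) ⧸ (galMap σ 𝔮 * galMap σ⁻¹ 𝔮),
        ∃! t : 𝓞 K, t ∈ T ∧ Ideal.Quotient.mk (galMap σ 𝔮 * galMap σ⁻¹ 𝔮) t = c) →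
      ∑ t ∈ T, quadSym (galMap σ 𝔮 * galMap σ⁻¹ 𝔮) t = 0 := by
  obtain ⟨P, J, hP, hP0, hJ0, h2, hle, hfactor⟩ :=
    exists_galMap_mul_galMap_eq hn hdeg hσ h𝔮bot h𝔮odd hp hpunram hpdvd hpsq
  rw [hfactor]
  exact fun T hT ↦ sum_quadSym_eq_zero hP0 hJ0 h2 hle T hT

end
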